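/- arXiv:0712.3946 — 6 statements merged into one kernel-verified Lean document; each statement's English description precedes it below -/
import Mathlib

section
/- For every nonnegative integer n, the identity ∑_{k=0}^{n} C(n,k) · (∑_{j=0}^{k} C(k,j)^3) = ∑_{k=0}^{n} C(n,k)^2 · C(2k,k) holds, where C(a,b) denotes the binomial coefficient. -/
open Polynomial in
theorem coeff_C_mul_X_add_C_pow {R : Type*} [CommSemiring R] (v w : R) {n i : ℕ} (hi : i ≤ n) :
    ((C v * X + C w) ^ n).coeff i = v ^ i * w ^ (n - i) * n.choose i := by
  have h : ∀ m : ℕ, (C v * X) ^ m * C w ^ (n - m) * (n.choose m : R[X]) =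
      C (v ^ m * w ^ (n - m) * n.choose m) * X ^ m := by
    intro m
    simp only [map_mul, map_pow, map_natCast]
    ring
  simp only [add_pow, h, finsetSum_coeff, coeff_C_mul_X_pow]
  rw [Finset.sum_ite_eq, if_pos (Finset.mem_range.2 (by omega))]

open Polynomial in
theorem coeff_X_add_C_pow_mul_C_mul_X_add_C_pow {R : Type*} [CommSemiring R]
    (u v w : R) (n : ℕ) :
    ((X + C u) ^ n * (C v * X + C w) ^ n).coeff n =
      ∑ k ∈ Finset.range (n + 1), (n.choose k : R) ^ 2 * (u * v) ^ k * w ^ (n - k) := by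
  rw [mul_comm, coeff_mul, Finset.Nat.sum_antidiagonal_eq_sum_range_succ_mk]
  refine Finset.sum_congr rfl fun k hk => ?_
  have hk : k ≤ n := Nat.lt_succ_iff.1 (Finset.mem_range.1 hk)
  rw [coeff_C_mul_X_add_C_pow v w hk, coeff_X_add_C_pow, Nat.choose_symm hk, Nat.sub_sub_self hk]
  ring

open Polynomial in
theorem sum_choose_pow_three_eq_coeff (k : ℕ) :
    ∑ j ∈ Finset.range (k + 1), k.choose j ^ 3 =
      ((((X + C X) * (C 1 * X + C 1) * C (X + 1)) ^ k : ℕ[X][X]).coeff k).coeff k := by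
  rw [mul_pow (M := ℕ[X][X]), mul_pow (M := ℕ[X][X]), ← C_pow, coeff_mul_C, coeff_X_add_C_pow_mul_C_mul_X_add_C_pow,
    Finset.sum_mul, finsetSum_coeff]
  refine Finset.sum_congr rfl fun j hj => ?_
  have hj : j ≤ k := Nat.lt_succ_iff.1 (Finset.mem_range.1 hj)
  have h : (k.choose j : ℕ[X]) ^ 2 * (X * 1) ^ j * 1 ^ (k - j) * (X + 1) ^ k =
      C (k.choose j ^ 2) * ((X + 1) ^ k * X ^ j) := by
    simp only [map_pow, eq_natCast, one_pow, mul_one]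
    ring
  rw [h, coeff_C_mul, coeff_mul_X_pow', if_pos hj, coeff_X_add_one_pow, Nat.choose_symm hj]
  simp [pow_succ]

open Polynomial in
theorem sum_choose_sq_mul_centralBinom_eq_coeff (n : ℕ) :
    ∑ k ∈ Finset.range (n + 1), n.choose k ^ 2 * (2 * k).choose k =
      ((((X + C (X + 1)) * (C (X + 1) * X + C X)) ^ n : ℕ[X][X]).coeff n).coeff n := by
  rw [mul_pow (M := ℕ[X][X]), coeff_X_add_C_pow_mul_C_mul_X_add_C_pow, finsetSum_coeff]
  refine Finset.sum_congr rfl fun k hk => ?_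
  have hk : k ≤ n := Nat.lt_succ_iff.1 (Finset.mem_range.1 hk)
  have h : (n.choose k : ℕ[X]) ^ 2 * ((X + 1) * (X + 1)) ^ k * X ^ (n - k) =
      C (n.choose k ^ 2) * ((X + 1) ^ (2 * k) * X ^ (n - k)) := by
    simp only [map_pow, eq_natCast, pow_mul, sq (X + 1)]
    ring
  rw [h, coeff_C_mul, coeff_mul_X_pow', if_pos (Nat.sub_le n k), coeff_X_add_one_pow,
    Nat.sub_sub_self hk]
  simp

open Polynomial in
theorem barrucand_identity (n : ℕ) :
    ∑ k ∈ Finset.range (n + 1), n.choose k * ∑ j ∈ Finset.range (k + 1), (k.choose j) ^ 3 =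
    ∑ k ∈ Finset.range (n + 1), (n.choose k) ^ 2 * (2 * k).choose k := by
  -- `(x + y + z) (xy + yz + zx) = (x + y) (y + z) (z + x) + xyz` with `z = 1`
  have key : ((X + C (X + 1)) * (C (X + 1) * X + C X) : ℕ[X][X]) =
      (X + C X) * (C 1 * X + C 1) * C (X + 1) + C X * X := by
    simp only [map_add, map_one]
    ring
  rw [sum_choose_sq_mul_centralBinom_eq_coeff, key, add_pow (R := ℕ[X][X]), finsetSum_coeff, finsetSum_coeff]
  refine Finset.sum_congr rfl fun k hk => ?_
  have hk : k ≤ n := Nat.lt_succ_iff.1 (Finset.mem_range.1 hk)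
  rw [sum_choose_pow_three_eq_coeff]
  generalize ((X + C X) * (C 1 * X + C 1) * C (X + 1) : ℕ[X][X]) ^ k = p
  have h : p * (C X * X) ^ (n - k) * (n.choose k : ℕ[X][X]) =
      C (C (n.choose k) * X ^ (n - k)) * (p * X ^ (n - k)) := by
    simp only [map_mul, map_pow, eq_natCast, map_natCast]
    ring
  rw [h, coeff_C_mul, coeff_mul_X_pow', if_pos (Nat.sub_le n k), Nat.sub_sub_self hk, mul_assoc,
    coeff_C_mul, coeff_X_pow_mul', if_pos (Nat.sub_le n k), Nat.sub_sub_self hk]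
end

section
/- For every nonnegative integer n, the number of functions f : Fin 3 × Fin n → Fin 3 such that f(c,d) ≠ c for every card (c,d), and such that for every player p ∈ Fin 3 the fiber f⁻¹({p}) has cardinality n, equals ∑_{j=0}^{n} C(n,j)^3. -/
/-- The deal in which card `(c, d)` goes to player `c + 1` if `d ∈ S c` and to player `c + 2`
otherwise. -/
def dealOfSets {n : ℕ} (S : Fin 3 → Finset (Fin n)) (x : Fin 3 × Fin n) : Fin 3 :=
  if x.2 ∈ S x.1 then x.1 + 1 else x.1 + 2

/-- The denominations of the cards of color `c` that go to player `c + 1`. -/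
def setsOfDeal {n : ℕ} (f : Fin 3 × Fin n → Fin 3) (c : Fin 3) : Finset (Fin n) :=
  Finset.univ.filter (fun d => f (c, d) = c + 1)

theorem dealOfSets_ne {n : ℕ} (S : Fin 3 → Finset (Fin n)) (x : Fin 3 × Fin n) :
    dealOfSets S x ≠ x.1 := by
  have h : ∀ c : Fin 3, c + 1 ≠ c ∧ c + 2 ≠ c := by decide
  unfold dealOfSets
  split_ifs
  exacts [(h _).1, (h _).2]

theorem setsOfDeal_dealOfSets {n : ℕ} (S : Fin 3 → Finset (Fin n)) :
    setsOfDeal (dealOfSets S) = S := by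
  ext c d
  by_cases hd : d ∈ S c <;> simp [setsOfDeal, dealOfSets, hd]

theorem dealOfSets_setsOfDeal {n : ℕ} {f : Fin 3 × Fin n → Fin 3} (hf : ∀ x, f x ≠ x.1) :
    dealOfSets (setsOfDeal f) = f := by
  have h : ∀ c p : Fin 3, p ≠ c → p ≠ c + 1 → c + 2 = p := by decide
  ext1 ⟨c, d⟩
  by_cases hd : f (c, d) = c + 1
  · simp [setsOfDeal, dealOfSets, hd]
  · simp [setsOfDeal, dealOfSets, hd, h c _ (hf (c, d)) hd]

theorem card_dealOfSets_fiber {n : ℕ} (S : Fin 3 → Finset (Fin n)) (p : Fin 3) :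
    (Finset.univ.filter (fun x => dealOfSets S x = p)).card + (S (p + 1)).card =
      n + (S (p + 2)).card := by
  have hS (c : Fin 3) : (Finset.univ.filter (fun d => d ∉ S c)).card + (S c).card = n := by
    have h := Finset.card_filter_add_card_filter_not (s := Finset.univ) (fun d => d ∈ S c)
    simp only [Finset.filter_univ_mem, Finset.card_univ, Fintype.card_fin] at h
    omega
  have hsplit : (Finset.univ.filter (fun x => dealOfSets S x = p)).card =
      ∑ c, (Finset.univ.filter (fun d => dealOfSets S (c, d) = p)).card := by
    simp only [Finset.card_filter, Fintype.sum_prod_type]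
  have hsum : ∀ (p : Fin 3) (g : Fin 3 → ℕ), ∑ c, g c = g p + g (p + 1) + g (p + 2) := by
    intro p g
    fin_cases p <;> simp [Fin.sum_univ_three] <;> ring
  have hp : p + 1 ≠ p ∧ p + 2 ≠ p ∧ p + 1 + 1 ≠ p ∧ p + 1 + 2 = p ∧ p + 2 + 1 = p ∧
      p + 2 + 2 ≠ p := by
    clear hsplit; revert p; decide
  obtain ⟨h1, h2, h3, h4, h5, h6⟩ := hp
  have e0 : (Finset.univ.filter (fun d => dealOfSets S (p, d) = p)).card = 0 := by
    simp [dealOfSets_ne S (p, _)]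
  have e1 : Finset.univ.filter (fun d => dealOfSets S (p + 1, d) = p) =
      Finset.univ.filter (fun d => d ∉ S (p + 1)) := by
    ext d
    by_cases hd : d ∈ S (p + 1) <;> simp only [dealOfSets, hd, Finset.mem_filter] <;> simp [h3, h4]
  have e2 : Finset.univ.filter (fun d => dealOfSets S (p + 2, d) = p) = S (p + 2) := by
    ext d
    by_cases hd : d ∈ S (p + 2) <;> simp only [dealOfSets, hd, Finset.mem_filter] <;> simp [h5, h6]
  rw [hsplit, hsum p, e0, e1, e2]
  have := hS (p + 1)
  omega

theorem forall_card_dealOfSets_fiber_iff {n : ℕ} (S : Fin 3 → Finset (Fin n)) :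
    (∀ p, (Finset.univ.filter (fun x => dealOfSets S x = p)).card = n) ↔
      ∀ c, (S c).card = (S 0).card := by
  have h := card_dealOfSets_fiber S
  simp [Fin.forall_fin_succ] at h ⊢
  omega

theorem card_filter_card_eq {n : ℕ} :
    (Finset.univ.filter
      (fun S : Fin 3 → Finset (Fin n) => ∀ c, (S c).card = (S 0).card)).card =
    ∑ j ∈ Finset.range (n + 1), (n.choose j) ^ 3 := by
  rw [Finset.card_eq_sum_card_fiberwise (f := fun S => (S 0).card) (t := Finset.range (n + 1))]
  · refine Finset.sum_congr rfl fun j _ => ?_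
    have h : (Finset.univ.filter
        (fun S : Fin 3 → Finset (Fin n) => ∀ c, (S c).card = (S 0).card)).filter
          (fun S => (S 0).card = j) =
        Fintype.piFinset fun _ => Finset.powersetCard j Finset.univ := by
      ext S
      simp only [Finset.mem_filter, Finset.mem_univ, true_and, Fintype.mem_piFinset,
        Finset.mem_powersetCard, Finset.subset_univ]
      exact ⟨fun h c => (h.1 c).trans h.2, fun h => ⟨fun c => (h c).trans (h 0).symm, h 0⟩⟩
    rw [h]
    simp
  · intro S _
    have := Finset.card_le_univ (S 0)
    simp only [Fintype.card_fin] at this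
    simp only [Finset.coe_range, Set.mem_Iio]
    omega

theorem franel_count_deals (n : ℕ) :
    (Finset.univ.filter (fun f : Fin 3 × Fin n → Fin 3 =>
        (∀ x : Fin 3 × Fin n, f x ≠ x.1) ∧
        (∀ p : Fin 3, (Finset.univ.filter (fun x : Fin 3 × Fin n => f x = p)).card = n))).card =
    ∑ j ∈ Finset.range (n + 1), (n.choose j) ^ 3 := by
  rw [← card_filter_card_eq]
  refine Finset.card_nbij' setsOfDeal dealOfSets ?_ ?_ ?_ ?_
  · intro f hf
    simp only [Finset.coe_filter, Finset.mem_univ, true_and, Set.mem_ofPred_eq] at hf ⊢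
    rw [← forall_card_dealOfSets_fiber_iff, dealOfSets_setsOfDeal hf.1]
    exact hf.2
  · intro S hS
    simp only [Finset.coe_filter, Finset.mem_univ, true_and, Set.mem_ofPred_eq] at hS ⊢
    exact ⟨dealOfSets_ne S, (forall_card_dealOfSets_fiber_iff S).2 hS⟩
  · intro f hf
    simp only [Finset.coe_filter, Finset.mem_univ, true_and, Set.mem_ofPred_eq] at hf
    exact dealOfSets_setsOfDeal hf.1
  · intro S _
    exact setsOfDeal_dealOfSets S
end

section
/- Let n and k be nonnegative integers with k ≤ n, and let D ⊆ Fin n be a fixed set of denominations with |D| = k. Then the number of pairs (S, f), where S ⊆ Fin n and f : Fin 3 × Fin n → Option (Fin 3) satisfies: (i) f(c,d) = none if and only if d ∉ S; (ii) whenever f(c,d) = some p, then p ≠ c; (iii) for each player p ∈ Fin 3, the set of cards mapped to some p has cardinality |S|; and (iv) the set of denominations d such that f(c,d) = some 0 for some color c equals D, is exactly C(n,k) · C(2k,k). -/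
namespace CardDeal

variable {n : ℕ}

/-- The denominations whose green and blue cards do not both go to the red player. -/
def notBothRed (f : Fin 3 × Fin n → Option (Fin 3)) : Finset (Fin n) :=
  Finset.univ.filter fun d => f (1, d) = some 2 ∨ f (2, d) = some 1

/-- Two sets of denominations, as one subset of a disjoint union: those whose green card goes to
blue while the blue card goes to red, and those whose red card goes to blue. -/
def marks (f : Fin 3 × Fin n → Option (Fin 3)) : Finset (Fin n ⊕ Fin n) :=
  (Finset.univ.filter fun d => f (1, d) = some 2 ∧ f (2, d) = some 0).disjSum
    (Finset.univ.filter fun d => f (0, d) = some 2)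

/-- The deal with prescribed red denominations `D`, recovered from its `notBothRed` and `marks`. -/
def ofMarks (D T : Finset (Fin n)) (U : Finset (Fin n ⊕ Fin n)) (x : Fin 3 × Fin n) :
    Option (Fin 3) :=
  if x.2 ∈ D ∪ T then
    some (![if .inr x.2 ∈ U then 2 else 1,
      if .inl x.2 ∈ U ∨ x.2 ∉ D then 2 else 0,
      if .inl x.2 ∈ U ∨ x.2 ∉ T then 0 else 1] x.1)
  else none

/-- A deal without the requirement that the three hands have equal sizes. -/
structure IsColorAvoiding (S : Finset (Fin n)) (f : Fin 3 × Fin n → Option (Fin 3)) : Prop where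
  eq_none_iff : ∀ x, f x = none ↔ x.2 ∉ S
  ne_color : ∀ x p, f x = some p → p ≠ x.1

/-- The denominations in the red player's hand. -/
abbrev redDenominations (f : Fin 3 × Fin n → Option (Fin 3)) : Finset (Fin n) :=
  Finset.univ.filter fun d => ∃ c : Fin 3, f (c, d) = some 0

/-- The cards dealt to player `p`. -/
abbrev hand (f : Fin 3 × Fin n → Option (Fin 3)) (p : Fin 3) : Finset (Fin 3 × Fin n) :=
  Finset.univ.filter fun x => f x = some p

lemma card_hand (f : Fin 3 × Fin n → Option (Fin 3)) (p : Fin 3) :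
    (hand f p).card = ∑ d, ((if f (0, d) = some p then 1 else 0) +
      (if f (1, d) = some p then 1 else 0) + (if f (2, d) = some p then 1 else 0)) := by
  simp_rw [hand, Finset.card_filter, Fintype.sum_prod_type_right, Fin.sum_univ_three]

lemma card_eq_sum_ite (S : Finset (Fin n)) : S.card = ∑ d, if d ∈ S then 1 else 0 := by
  simp

namespace IsColorAvoiding

variable {S : Finset (Fin n)} {f : Fin 3 × Fin n → Option (Fin 3)}

lemma cases (h : IsColorAvoiding S f) (d : Fin n) :
    (d ∉ S ∧ f (0, d) = none ∧ f (1, d) = none ∧ f (2, d) = none) ∨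
    (d ∈ S ∧ (f (0, d) = some 1 ∨ f (0, d) = some 2) ∧ (f (1, d) = some 0 ∨ f (1, d) = some 2) ∧
      (f (2, d) = some 0 ∨ f (2, d) = some 1)) := by
  by_cases hd : d ∈ S
  · have key (c : Fin 3) : ∃ p, f (c, d) = some p ∧ p ≠ c := by
      obtain ⟨p, hp⟩ := Option.ne_none_iff_exists'.1 fun h0 => (h.eq_none_iff (c, d)).1 h0 hd
      exact ⟨p, hp, h.ne_color _ _ hp⟩
    obtain ⟨p, hp, hp'⟩ := key 0
    obtain ⟨q, hq, hq'⟩ := key 1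
    obtain ⟨r, hr, hr'⟩ := key 2
    refine .inr ⟨hd, ?_, ?_, ?_⟩
    · rw [hp]; fin_cases p <;> simp_all
    · rw [hq]; fin_cases q <;> simp_all
    · rw [hr]; fin_cases r <;> simp_all
  · exact .inl ⟨hd, (h.eq_none_iff _).2 hd, (h.eq_none_iff _).2 hd, (h.eq_none_iff _).2 hd⟩

lemma card_notBothRed_add (h : IsColorAvoiding S f) :
    (notBothRed f).card + (hand f 0).card = (redDenominations f).card + S.card := by
  rw [card_hand, card_eq_sum_ite S, notBothRed, redDenominations, Finset.card_filter,
    Finset.card_filter, ← Finset.sum_add_distrib, ← Finset.sum_add_distrib]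
  refine Finset.sum_congr rfl fun d _ => ?_
  rcases h.cases d with ⟨hd, h0, h1, h2⟩ | ⟨hd, h0 | h0, h1 | h1, h2 | h2⟩ <;>
    simp [Fin.exists_fin_succ, hd, h0, h1, h2]

lemma card_marks_add (h : IsColorAvoiding S f) :
    (marks f).card + S.card = (hand f 2).card + (redDenominations f).card := by
  rw [card_hand, card_eq_sum_ite S, marks, redDenominations, Finset.card_disjSum,
    Finset.card_filter, Finset.card_filter, Finset.card_filter, ← Finset.sum_add_distrib,
    ← Finset.sum_add_distrib, ← Finset.sum_add_distrib]
  refine Finset.sum_congr rfl fun d _ => ?_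
  rcases h.cases d with ⟨hd, h0, h1, h2⟩ | ⟨hd, h0 | h0, h1 | h1, h2 | h2⟩ <;>
    simp [Fin.exists_fin_succ, hd, h0, h1, h2]

lemma sum_card_hand (h : IsColorAvoiding S f) :
    (hand f 0).card + (hand f 1).card + (hand f 2).card = 3 * S.card := by
  rw [card_hand, card_hand, card_hand, card_eq_sum_ite S, Finset.mul_sum,
    ← Finset.sum_add_distrib, ← Finset.sum_add_distrib]
  refine Finset.sum_congr rfl fun d _ => ?_
  rcases h.cases d with ⟨hd, h0, h1, h2⟩ | ⟨hd, h0 | h0, h1 | h1, h2 | h2⟩ <;>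
    simp [hd, h0, h1, h2]

lemma card_hand_eq_iff (h : IsColorAvoiding S f) :
    (∀ p, (hand f p).card = S.card) ↔ (notBothRed f).card = (redDenominations f).card ∧
      (marks f).card = (redDenominations f).card := by
  have h0 := h.card_notBothRed_add
  have h1 := h.card_marks_add
  have h2 := h.sum_card_hand
  rw [Fin.forall_fin_succ, Fin.forall_fin_two]
  change (hand f 0).card = _ ∧ (hand f 1).card = _ ∧ (hand f 2).card = _ ↔ _
  omega

lemma redDenominations_union_notBothRed (h : IsColorAvoiding S f) :
    redDenominations f ∪ notBothRed f = S := by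
  ext d
  rcases h.cases d with ⟨hd, h0, h1, h2⟩ | ⟨hd, h0 | h0, h1 | h1, h2 | h2⟩ <;>
    simp [notBothRed, Fin.exists_fin_succ, hd, h0, h1, h2]

lemma marks_subset (h : IsColorAvoiding S f) :
    marks f ⊆ (redDenominations f ∩ notBothRed f).disjSum (redDenominations f ∪ notBothRed f) := by
  rintro (d | d) <;>
  rcases h.cases d with ⟨hd, h0, h1, h2⟩ | ⟨hd, h0 | h0, h1 | h1, h2 | h2⟩ <;>
    simp [marks, notBothRed, Fin.exists_fin_succ, h0, h1, h2]

lemma ofMarks_marks (h : IsColorAvoiding S f) :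
    ofMarks (redDenominations f) (notBothRed f) (marks f) = f := by
  ext1 ⟨c, d⟩
  rw [ofMarks, h.redDenominations_union_notBothRed]
  rcases h.cases d with ⟨hd, h0, h1, h2⟩ | ⟨hd, h0 | h0, h1 | h1, h2 | h2⟩ <;>
  fin_cases c <;>
    simp [marks, notBothRed, Fin.exists_fin_succ, hd, h0, h1, h2]

end IsColorAvoiding

section ofMarks

variable {D T : Finset (Fin n)} {U : Finset (Fin n ⊕ Fin n)}

lemma isColorAvoiding_ofMarks : IsColorAvoiding (D ∪ T) (ofMarks D T U) where
  eq_none_iff x := by simp [ofMarks]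
  ne_color := by
    rintro ⟨c, d⟩ p hp
    unfold ofMarks at hp
    split_ifs at hp <;> obtain rfl := Option.some.inj hp <;> fin_cases c <;> simp

lemma redDenominations_ofMarks (hU : U ⊆ (D ∩ T).disjSum (D ∪ T)) :
    redDenominations (ofMarks D T U) = D := by
  ext d
  have hl := @hU (.inl d)
  by_cases hD : d ∈ D <;> by_cases hT : d ∈ T <;> by_cases h1 : Sum.inl d ∈ U <;>
    by_cases h2 : Sum.inr d ∈ U <;> simp_all [ofMarks, Fin.exists_fin_succ]

lemma notBothRed_ofMarks (hU : U ⊆ (D ∩ T).disjSum (D ∪ T)) :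
    notBothRed (ofMarks D T U) = T := by
  ext d
  have hl := @hU (.inl d)
  by_cases hD : d ∈ D <;> by_cases hT : d ∈ T <;> by_cases h1 : Sum.inl d ∈ U <;>
    by_cases h2 : Sum.inr d ∈ U <;> simp_all [ofMarks, notBothRed]

lemma marks_ofMarks (hU : U ⊆ (D ∩ T).disjSum (D ∪ T)) :
    marks (ofMarks D T U) = U := by
  ext (d | d) <;>
  have hl := @hU (.inl d) <;>
  have hr := @hU (.inr d) <;>
  by_cases hD : d ∈ D <;> by_cases hT : d ∈ T <;> by_cases h1 : Sum.inl d ∈ U <;>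
    by_cases h2 : Sum.inr d ∈ U <;> simp_all [ofMarks, marks]

end ofMarks

lemma card_sigma_marks (D : Finset (Fin n)) :
    ((Finset.univ.powersetCard D.card).sigma fun T =>
      ((D ∩ T).disjSum (D ∪ T)).powersetCard D.card).card =
    n.choose D.card * (2 * D.card).choose D.card := by
  rw [Finset.card_sigma, Finset.sum_const_nat (m := (2 * D.card).choose D.card),
    Finset.card_powersetCard, Finset.card_fin]
  intro T hT
  rw [Finset.card_powersetCard, Finset.card_disjSum, Finset.card_inter_add_card_union,
    (Finset.mem_powersetCard.1 hT).2, two_mul]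

end CardDeal

open CardDeal

theorem deals_with_fixed_red_denominations (n k : ℕ) (hk : k ≤ n)
    (D : Finset (Fin n)) (hD : D.card = k) :
    (Finset.univ.filter (fun Sf : Finset (Fin n) × (Fin 3 × Fin n → Option (Fin 3)) =>
        (∀ x : Fin 3 × Fin n, Sf.2 x = none ↔ x.2 ∉ Sf.1) ∧
        (∀ x : Fin 3 × Fin n, ∀ p : Fin 3, Sf.2 x = some p → p ≠ x.1) ∧
        (∀ p : Fin 3,
          (Finset.univ.filter (fun x : Fin 3 × Fin n => Sf.2 x = some p)).card = Sf.1.card) ∧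
        (Finset.univ.filter (fun d : Fin n => ∃ c : Fin 3, Sf.2 (c, d) = some 0) = D))).card =
    n.choose k * (2 * k).choose k := by
  subst hD
  rw [← card_sigma_marks D]
  refine Finset.card_nbij' (fun Sf => ⟨notBothRed Sf.2, marks Sf.2⟩)
    (fun TU => (D ∪ TU.1, ofMarks D TU.1 TU.2)) ?_ ?_ ?_ ?_
  · rintro ⟨S, f⟩ h
    obtain ⟨hS, hc, hcard, rfl⟩ := (Finset.mem_filter.1 h).2
    have hf : IsColorAvoiding S f := ⟨hS, hc⟩
    obtain ⟨hT, hU⟩ := hf.card_hand_eq_iff.1 hcard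
    exact Finset.mem_sigma.2 ⟨Finset.mem_powersetCard.2 ⟨Finset.subset_univ _, hT⟩,
      Finset.mem_powersetCard.2 ⟨hf.marks_subset, hU⟩⟩
  · rintro ⟨T, U⟩ h
    obtain ⟨hT, hU⟩ := Finset.mem_sigma.1 h
    obtain ⟨-, hT⟩ := Finset.mem_powersetCard.1 hT
    obtain ⟨hU, hU'⟩ := Finset.mem_powersetCard.1 hU
    have hf : IsColorAvoiding (D ∪ T) (ofMarks D T U) := isColorAvoiding_ofMarks
    refine Finset.mem_filter.2 ⟨Finset.mem_univ _, hf.eq_none_iff, hf.ne_color,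
      hf.card_hand_eq_iff.2 ?_, redDenominations_ofMarks hU⟩
    rw [redDenominations_ofMarks hU, notBothRed_ofMarks hU, marks_ofMarks hU]
    exact ⟨hT, hU'⟩
  · rintro ⟨S, f⟩ h
    obtain ⟨hS, hc, -, rfl⟩ := (Finset.mem_filter.1 h).2
    have hf : IsColorAvoiding S f := ⟨hS, hc⟩
    exact Prod.ext hf.redDenominations_union_notBothRed hf.ofMarks_marks
  · rintro ⟨T, U⟩ h
    obtain ⟨hU, -⟩ := Finset.mem_powersetCard.1 (Finset.mem_sigma.1 h).2
    exact Sigma.ext (notBothRed_ofMarks hU) (heq_of_eq (marks_ofMarks hU))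
end

section
/- Let n and k be nonnegative integers with k ≤ n. The number of pairs (S, f), where S ⊆ Fin n with |S| = k and f : Fin 3 × Fin n → Option (Fin 3) satisfies: (i) f(c,d) = none if and only if d ∉ S; (ii) whenever f(c,d) = some p, then p ≠ c; and (iii) for each player p ∈ Fin 3, the set of cards mapped to some p has cardinality k, is exactly C(n,k) · ∑_{j=0}^{k} C(k,j)^3. -/
/-- The denominations of the cards of color `c` that go to player `c + 1`. -/
def passedToNext {n : ℕ} (f : Fin 3 × Fin n → Option (Fin 3)) (c : Fin 3) : Finset (Fin n) :=
  Finset.univ.filter (fun d => f (c, d) = some (c + 1))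

/-- The deal on the denominations `S` in which player `c + 1` receives the cards of color `c` with
denomination in `A c` and player `c + 2` receives the other ones. -/
def dealOfPassed {n : ℕ} (S : Finset (Fin n)) (A : Fin 3 → Finset (Fin n)) :
    Fin 3 × Fin n → Option (Fin 3) :=
  fun x => if x.2 ∈ S then (if x.2 ∈ A x.1 then some (x.1 + 1) else some (x.1 + 2)) else none

theorem Fin.three_eq_add_of_ne : ∀ {p c : Fin 3}, p ≠ c → p = c + 1 ∨ p = c + 2 := by decide

section Deal

variable {n : ℕ} {S : Finset (Fin n)} {f : Fin 3 × Fin n → Option (Fin 3)}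

theorem passedToNext_subset (hS : ∀ x, f x = none ↔ x.2 ∉ S) (c : Fin 3) :
    passedToNext f c ⊆ S := by
  intro d hd
  by_contra h
  have := (hS (c, d)).2 h
  simp_all [passedToNext]

theorem dealOfPassed_passedToNext (hS : ∀ x, f x = none ↔ x.2 ∉ S)
    (hne : ∀ x p, f x = some p → p ≠ x.1) : dealOfPassed S (passedToNext f) = f := by
  funext ⟨c, d⟩
  have h := hS (c, d)
  cases hf : f (c, d) with
  | none => simp_all [dealOfPassed]
  | some p =>
    rcases Fin.three_eq_add_of_ne (hne _ _ hf) with rfl | rfl <;>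
      simp_all [dealOfPassed, passedToNext]

theorem passedToNext_dealOfPassed {A : Fin 3 → Finset (Fin n)} (hA : ∀ c, A c ⊆ S) :
    passedToNext (dealOfPassed S A) = A := by
  funext c
  ext d
  have := @hA c d
  by_cases h : d ∈ A c <;> by_cases h' : d ∈ S <;> simp_all [dealOfPassed, passedToNext]

theorem dealOfPassed_eq_none_iff (A : Fin 3 → Finset (Fin n)) (x : Fin 3 × Fin n) :
    dealOfPassed S A x = none ↔ x.2 ∉ S := by
  unfold dealOfPassed
  split_ifs <;> simp_all

theorem ne_of_dealOfPassed_eq_some (A : Fin 3 → Finset (Fin n)) (x : Fin 3 × Fin n) (p : Fin 3)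
    (h : dealOfPassed S A x = some p) : p ≠ x.1 := by
  unfold dealOfPassed at h
  split_ifs at h <;> simp only [Option.some.injEq] at h <;> subst h <;> simp

/-- A hand consists of the cards passed by the color two ahead and those not passed by the next
color. -/
theorem card_hand_add_card_passedToNext (hS : ∀ x, f x = none ↔ x.2 ∉ S)
    (hne : ∀ x p, f x = some p → p ≠ x.1) (p : Fin 3) :
    (Finset.univ.filter (fun x => f x = some p)).card + (passedToNext f (p + 1)).card =
      (passedToNext f (p + 2)).card + S.card := by
  have hand : (Finset.univ.filter (fun x => f x = some p)) =
      (passedToNext f (p + 2)).map (Function.Embedding.sectR (p + 2) (Fin n)) ∪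
      (S \ passedToNext f (p + 1)).map (Function.Embedding.sectR (p + 1) (Fin n)) := by
    have e1 : p + 2 + 1 = p := by revert p; decide
    have e2 : p + 1 + 1 ≠ p := by revert p; decide
    have e3 : p + 1 + 2 = p := by revert p; decide
    ext ⟨c, d⟩
    simp only [Finset.mem_filter, Finset.mem_univ, true_and, Finset.mem_union, Finset.mem_map,
      Function.Embedding.sectR_apply, Prod.mk.injEq, Finset.mem_sdiff, passedToNext, e1]
    constructor
    · intro h
      rcases Fin.three_eq_add_of_ne (hne _ _ h).symm with rfl | rfl
      · refine Or.inr ⟨d, ⟨?_, ?_⟩, rfl, rfl⟩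
        · have := hS (p + 1, d)
          simp_all
        · simpa [h] using e2.symm
      · exact Or.inl ⟨d, h, rfl, rfl⟩
    · rintro (⟨d, h, rfl, rfl⟩ | ⟨d, ⟨h, h'⟩, rfl, rfl⟩)
      · exact h
      · have := hS (p + 1, d)
        cases hf : f (p + 1, d) with
        | none => simp_all
        | some q =>
          rcases Fin.three_eq_add_of_ne (hne _ _ hf) with rfl | rfl
          · exact absurd hf h'
          · simp only [e3]
  have disj : Disjoint
      ((passedToNext f (p + 2)).map (Function.Embedding.sectR (p + 2) (Fin n)))
      ((S \ passedToNext f (p + 1)).map (Function.Embedding.sectR (p + 1) (Fin n))) := by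
    rw [Finset.disjoint_left]
    simp only [Finset.mem_map, Function.Embedding.sectR_apply]
    rintro _ ⟨d, -, rfl⟩ ⟨d', -, h⟩
    simp at h
  rw [hand, Finset.card_union_of_disjoint disj, Finset.card_map, Finset.card_map, add_assoc,
    Finset.card_sdiff_add_card_eq_card (passedToNext_subset hS _)]

theorem forall_card_hand_eq_iff (hS : ∀ x, f x = none ↔ x.2 ∉ S)
    (hne : ∀ x p, f x = some p → p ≠ x.1) :
    (∀ p, (Finset.univ.filter (fun x => f x = some p)).card = S.card) ↔
      ∀ c, (passedToNext f c).card = (passedToNext f 0).card := by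
  have h0 := card_hand_add_card_passedToNext hS hne 0
  have h1 := card_hand_add_card_passedToNext hS hne 1
  have h2 := card_hand_add_card_passedToNext hS hne 2
  have forall_three (P : Fin 3 → Prop) : (∀ i, P i) ↔ P 0 ∧ P 1 ∧ P 2 :=
    ⟨fun h => ⟨h 0, h 1, h 2⟩, fun ⟨h, h', h''⟩ i => by fin_cases i <;> assumption⟩
  rw [forall_three, forall_three]
  simp only [zero_add, show (1 + 1 : Fin 3) = 2 from rfl, show (1 + 2 : Fin 3) = 0 from rfl,
    show (2 + 1 : Fin 3) = 0 from rfl, show (2 + 2 : Fin 3) = 1 from rfl] at h0 h1 h2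
  omega

end Deal

theorem card_sigma_passed (n k : ℕ) :
    ((Finset.powersetCard k (Finset.univ : Finset (Fin n))).sigma fun S =>
      (Finset.range (k + 1)).sigma fun j =>
        Fintype.piFinset fun _ : Fin 3 => Finset.powersetCard j S).card =
      n.choose k * ∑ j ∈ Finset.range (k + 1), (k.choose j) ^ 3 := by
  rw [Finset.card_sigma, Finset.sum_congr rfl (g := fun _ =>
    ∑ j ∈ Finset.range (k + 1), (k.choose j) ^ 3)]
  · simp
  · intro S hS
    simp [Finset.card_sigma, (Finset.mem_powersetCard.1 hS).2]


theorem deals_with_denomination_set_size (n k : ℕ) (hk : k ≤ n) :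
    (Finset.univ.filter (fun Sf : Finset (Fin n) × (Fin 3 × Fin n → Option (Fin 3)) =>
        Sf.1.card = k ∧
        (∀ x : Fin 3 × Fin n, Sf.2 x = none ↔ x.2 ∉ Sf.1) ∧
        (∀ x : Fin 3 × Fin n, ∀ p : Fin 3, Sf.2 x = some p → p ≠ x.1) ∧
        (∀ p : Fin 3,
          (Finset.univ.filter (fun x : Fin 3 × Fin n => Sf.2 x = some p)).card = k))).card =
    n.choose k * ∑ j ∈ Finset.range (k + 1), (k.choose j) ^ 3 := by
  rw [← card_sigma_passed]
  refine Finset.card_bij'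
    (fun Sf _ => ⟨Sf.1, (passedToNext Sf.2 0).card, passedToNext Sf.2⟩)
    (fun t _ => (t.1, dealOfPassed t.1 t.2.2)) ?_ ?_ ?_ ?_
  · rintro ⟨S, f⟩ h
    obtain ⟨rfl, hS, hne, hc⟩ := (Finset.mem_filter.1 h).2
    have hsub := passedToNext_subset hS
    simpa [Finset.mem_powersetCard, hsub, Nat.lt_succ_iff, Finset.card_le_card (hsub 0)] using
      (forall_card_hand_eq_iff hS hne).1 hc
  · rintro ⟨S, j, A⟩ h
    simp only [Finset.mem_sigma, Fintype.mem_piFinset, Finset.mem_powersetCard] at h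
    obtain ⟨⟨-, rfl⟩, -, hA⟩ := h
    refine Finset.mem_filter.2 ⟨Finset.mem_univ _, rfl, dealOfPassed_eq_none_iff A,
      ne_of_dealOfPassed_eq_some A, ?_⟩
    refine (forall_card_hand_eq_iff (dealOfPassed_eq_none_iff A)
      (ne_of_dealOfPassed_eq_some A)).2 fun c => ?_
    rw [passedToNext_dealOfPassed fun c => (hA c).1, (hA c).2, (hA 0).2]
  · rintro ⟨S, f⟩ h
    obtain ⟨-, hS, hne, -⟩ := (Finset.mem_filter.1 h).2
    exact Prod.ext rfl (dealOfPassed_passedToNext hS hne)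
  · rintro ⟨S, j, A⟩ h
    simp only [Finset.mem_sigma, Fintype.mem_piFinset, Finset.mem_powersetCard] at h
    obtain ⟨-, -, hA⟩ := h
    simp only [passedToNext_dealOfPassed fun c => (hA c).1, (hA 0).2]
end

section
/- Let n and k be nonnegative integers with k ≤ n. The number of pairs (S, f), where S ⊆ Fin n and f : Fin 3 × Fin n → Option (Fin 3) satisfies: (i) f(c,d) = none if and only if d ∉ S; (ii) whenever f(c,d) = some p, then p ≠ c; (iii) for each player p ∈ Fin 3, the set of cards mapped to some p has cardinality |S|; and (iv) the set of denominations d such that f(c,d) = some 0 for some color c has cardinality k, is exactly C(n,k)^2 · C(2k,k). -/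
/-- Every card of a denomination in `S` is dealt, to a player of another color, and no other
card is dealt. -/
def IsDealOn {n : ℕ} (S : Finset (Fin n)) (f : Fin 3 × Fin n → Option (Fin 3)) : Prop :=
  (∀ x, f x = none ↔ x.2 ∉ S) ∧ ∀ x p, f x = some p → p ≠ x.1

namespace IsDealOn

variable {n : ℕ} {S : Finset (Fin n)} {f : Fin 3 × Fin n → Option (Fin 3)}

theorem cases (h : IsDealOn S f) (d : Fin n) :
    (d ∉ S ∧ f (0, d) = none ∧ f (1, d) = none ∧ f (2, d) = none) ∨
    (d ∈ S ∧ (f (0, d) = some 1 ∨ f (0, d) = some 2) ∧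
      (f (1, d) = some 0 ∨ f (1, d) = some 2) ∧ (f (2, d) = some 0 ∨ f (2, d) = some 1)) := by
  by_cases hd : d ∈ S
  · have key : ∀ c, ∃ p, f (c, d) = some p ∧ p ≠ c := fun c => by
      obtain ⟨p, hp⟩ := Option.ne_none_iff_exists'.1 (fun h0 => (h.1 (c, d)).1 h0 hd)
      exact ⟨p, hp, h.2 _ p hp⟩
    obtain ⟨p, hp, hp'⟩ := key 0
    obtain ⟨q, hq, hq'⟩ := key 1
    obtain ⟨r, hr, hr'⟩ := key 2
    refine Or.inr ⟨hd, ?_, ?_, ?_⟩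
    · rw [hp]; clear hp; decide +revert
    · rw [hq]; clear hq; decide +revert
    · rw [hr]; clear hr; decide +revert
  · exact Or.inl ⟨hd, (h.1 _).2 hd, (h.1 _).2 hd, (h.1 _).2 hd⟩

end IsDealOn

section Decoding

variable {n : ℕ} (f : Fin 3 × Fin n → Option (Fin 3))

/-- The cards dealt to player `p`. -/
def hand (p : Fin 3) : Finset (Fin 3 × Fin n) := Finset.univ.filter fun x => f x = some p

/-- The denominations in the hand of the red player. -/
def redDenoms : Finset (Fin n) := Finset.univ.filter fun d => ∃ c, f (c, d) = some 0

/-- The denominations in the hand of the red player whose red card goes to the blue player. -/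
def redDenomsToBlue : Finset (Fin n) :=
  Finset.univ.filter fun d => (∃ c, f (c, d) = some 0) ∧ f (0, d) = some 2

/-- The used denominations of which the red player does not hold two cards. -/
def nonDoubles : Finset (Fin n) :=
  Finset.univ.filter fun d => f (0, d) ≠ none ∧ ¬(f (1, d) = some 0 ∧ f (2, d) = some 0)

/-- The non-doubles that are weighted by their excess for the green player: those in the red
player's hand with blue card given to green, and the others with red card given to green. -/
def greenNonDoubles : Finset (Fin n) :=
  Finset.univ.filter fun d =>
    (f (1, d) = some 0 ∧ f (2, d) = some 1) ∨
      (f (0, d) = some 1 ∧ f (1, d) = some 2 ∧ f (2, d) = some 1)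

end Decoding

theorem card_hand {n : ℕ} (f : Fin 3 × Fin n → Option (Fin 3)) (p : Fin 3) :
    (hand f p).card = ∑ d, ((if f (0, d) = some p then 1 else 0) +
      (if f (1, d) = some p then 1 else 0) + (if f (2, d) = some p then 1 else 0)) := by
  simp only [hand, Finset.card_filter, Fintype.sum_prod_type_right, Fin.sum_univ_three]

theorem card_eq_sum_ite_mem {n : ℕ} (S : Finset (Fin n)) :
    S.card = ∑ d, if d ∈ S then 1 else 0 := by
  simp

namespace IsDealOn

variable {n : ℕ} {S : Finset (Fin n)} {f : Fin 3 × Fin n → Option (Fin 3)}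

theorem card_hand_zero (h : IsDealOn S f) :
    (hand f 0).card + (nonDoubles f).card = S.card + (redDenoms f).card := by
  rw [card_hand, card_eq_sum_ite_mem S, nonDoubles, redDenoms, Finset.card_filter,
    Finset.card_filter, ← Finset.sum_add_distrib, ← Finset.sum_add_distrib]
  refine Finset.sum_congr rfl fun d _ => ?_
  rcases h.cases d with ⟨hd, h0, h1, h2⟩ | ⟨hd, h0 | h0, h1 | h1, h2 | h2⟩ <;>
    simp [hd, h0, h1, h2, Fin.exists_fin_succ]

theorem card_hand_one (h : IsDealOn S f) :
    (hand f 1).card + (redDenomsToBlue f).card = S.card + (greenNonDoubles f).card := by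
  rw [card_hand, card_eq_sum_ite_mem S, redDenomsToBlue, greenNonDoubles, Finset.card_filter,
    Finset.card_filter, ← Finset.sum_add_distrib, ← Finset.sum_add_distrib]
  refine Finset.sum_congr rfl fun d _ => ?_
  rcases h.cases d with ⟨hd, h0, h1, h2⟩ | ⟨hd, h0 | h0, h1 | h1, h2 | h2⟩ <;>
    simp [hd, h0, h1, h2, Fin.exists_fin_succ]

theorem card_hand_sum (h : IsDealOn S f) :
    (hand f 0).card + (hand f 1).card + (hand f 2).card = S.card + S.card + S.card := by
  simp only [card_hand, card_eq_sum_ite_mem S, ← Finset.sum_add_distrib]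
  refine Finset.sum_congr rfl fun d _ => ?_
  rcases h.cases d with ⟨hd, h0, h1, h2⟩ | ⟨hd, h0 | h0, h1 | h1, h2 | h2⟩ <;>
    simp [hd, h0, h1, h2]

theorem card_hands_iff (h : IsDealOn S f) :
    (∀ p, (hand f p).card = S.card) ↔ (nonDoubles f).card = (redDenoms f).card ∧
      (greenNonDoubles f).card = (redDenomsToBlue f).card := by
  have h0 := h.card_hand_zero
  have h1 := h.card_hand_one
  have h2 := h.card_hand_sum
  simp only [Fin.forall_fin_succ, Fin.succ_zero_eq_one,
    Fin.succ_one_eq_two, IsEmpty.forall_iff, and_true]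
  omega

end IsDealOn

/-- The deal with `redDenoms`, `redDenomsToBlue`, `nonDoubles` and `greenNonDoubles` equal to
`T`, `B`, `W` and `A`. -/
def dealOf {n : ℕ} (T B W A : Finset (Fin n)) (x : Fin 3 × Fin n) : Option (Fin 3) :=
  if x.2 ∈ T then
    ![if x.2 ∈ B then some 2 else some 1,
      if x.2 ∈ W ∧ x.2 ∉ A then some 2 else some 0,
      if x.2 ∈ A then some 1 else some 0] x.1
  else if x.2 ∈ W then ![if x.2 ∈ A then some 1 else some 2, some 2, some 1] x.1
  else none

section DealOf

variable {n : ℕ} {T B W A : Finset (Fin n)}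

theorem isDealOn_dealOf : IsDealOn (T ∪ W) (dealOf T B W A) := by
  constructor
  · rintro ⟨c, d⟩
    fin_cases c <;> simp [dealOf] <;> grind
  · rintro ⟨c, d⟩ p
    fin_cases c <;> simp [dealOf] <;> grind

theorem redDenoms_dealOf (hA : A ⊆ W) : redDenoms (dealOf T B W A) = T := by
  ext d
  have := @hA d
  by_cases d ∈ T <;> by_cases d ∈ W <;> by_cases d ∈ A <;> by_cases d ∈ B <;>
    simp_all [redDenoms, dealOf, Fin.exists_fin_succ]

theorem redDenomsToBlue_dealOf (hB : B ⊆ T) (hA : A ⊆ W) :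
    redDenomsToBlue (dealOf T B W A) = B := by
  ext d
  have := @hA d
  have := @hB d
  by_cases d ∈ T <;> by_cases d ∈ W <;> by_cases d ∈ A <;> by_cases d ∈ B <;>
    simp_all [redDenomsToBlue, dealOf, Fin.exists_fin_succ]

theorem nonDoubles_dealOf (hA : A ⊆ W) : nonDoubles (dealOf T B W A) = W := by
  ext d
  have := @hA d
  by_cases d ∈ T <;> by_cases d ∈ W <;> by_cases d ∈ A <;> by_cases d ∈ B <;>
    simp_all [nonDoubles, dealOf]

theorem greenNonDoubles_dealOf (hA : A ⊆ W) : greenNonDoubles (dealOf T B W A) = A := by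
  ext d
  have := @hA d
  by_cases d ∈ T <;> by_cases d ∈ W <;> by_cases d ∈ A <;> by_cases d ∈ B <;>
    rw [greenNonDoubles, Finset.mem_filter_univ] <;> simp_all [dealOf]

end DealOf

namespace IsDealOn

variable {n : ℕ} {S : Finset (Fin n)} {f : Fin 3 × Fin n → Option (Fin 3)}

theorem redDenomsToBlue_subset : redDenomsToBlue f ⊆ redDenoms f := fun d => by
  simp +contextual [redDenomsToBlue, redDenoms]

theorem greenNonDoubles_subset (h : IsDealOn S f) : greenNonDoubles f ⊆ nonDoubles f := fun d => by
  rcases h.cases d with ⟨hd, h0, h1, h2⟩ | ⟨hd, h0 | h0, h1 | h1, h2 | h2⟩ <;>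
    simp [greenNonDoubles, nonDoubles, h0, h1, h2]

theorem redDenoms_union_nonDoubles (h : IsDealOn S f) : redDenoms f ∪ nonDoubles f = S := by
  ext d
  rcases h.cases d with ⟨hd, h0, h1, h2⟩ | ⟨hd, h0 | h0, h1 | h1, h2 | h2⟩ <;>
    simp [redDenoms, nonDoubles, hd, h0, h1, h2, Fin.exists_fin_succ]

theorem dealOf_eq (h : IsDealOn S f) :
    dealOf (redDenoms f) (redDenomsToBlue f) (nonDoubles f) (greenNonDoubles f) = f := by
  ext1 ⟨c, d⟩
  rcases h.cases d with ⟨hd, h0, h1, h2⟩ | ⟨hd, h0 | h0, h1 | h1, h2 | h2⟩ <;> fin_cases c <;>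
    simp [dealOf, redDenoms, redDenomsToBlue, nonDoubles, greenNonDoubles, h0, h1, h2,
      Fin.exists_fin_succ]

end IsDealOn

theorem card_pairs_subsets_card_eq {α : Type*} [DecidableEq α] {T W : Finset α} {k : ℕ}
    (hT : T.card = k) (hW : W.card = k) :
    ((T.powerset ×ˢ W.powerset).filter fun P => P.2.card = P.1.card).card =
      (2 * k).choose k := by
  rw [← Nat.sum_range_choose_sq, Finset.card_eq_sum_card_fiberwise
    (f := fun P => P.1.card) (t := Finset.range (k + 1))]
  · refine Finset.sum_congr rfl fun j _ => ?_
    trans (T.powersetCard j ×ˢ W.powersetCard j).card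
    swap
    · rw [Finset.card_product, Finset.card_powersetCard, Finset.card_powersetCard, hT, hW, sq]
    congr 1
    ext ⟨B, A⟩
    simp only [Finset.mem_filter, Finset.mem_product, Finset.mem_powerset,
      Finset.mem_powersetCard]
    grind
  · rintro ⟨B, A⟩ h
    simp only [Finset.coe_filter, Finset.mem_product, Finset.mem_powerset, Set.mem_ofPred_eq] at h
    simpa [Nat.lt_succ_iff, ← hT] using Finset.card_le_card h.1.1


theorem deals_with_red_denomination_count (n k : ℕ) (hk : k ≤ n) :
    (Finset.univ.filter (fun Sf : Finset (Fin n) × (Fin 3 × Fin n → Option (Fin 3)) =>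
        (∀ x : Fin 3 × Fin n, Sf.2 x = none ↔ x.2 ∉ Sf.1) ∧
        (∀ x : Fin 3 × Fin n, ∀ p : Fin 3, Sf.2 x = some p → p ≠ x.1) ∧
        (∀ p : Fin 3,
          (Finset.univ.filter (fun x : Fin 3 × Fin n => Sf.2 x = some p)).card = Sf.1.card) ∧
        (Finset.univ.filter (fun d : Fin n => ∃ c : Fin 3, Sf.2 (c, d) = some 0)).card = k)).card =
    (n.choose k) ^ 2 * (2 * k).choose k := by

  classical
  let target : Finset (Σ _ : Finset (Fin n) × Finset (Fin n),
      Finset (Fin n) × Finset (Fin n)) :=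
    (Finset.univ.powersetCard k ×ˢ Finset.univ.powersetCard k).sigma fun Q =>
      (Q.1.powerset ×ˢ Q.2.powerset).filter fun P => P.2.card = P.1.card
  trans target.card
  · refine Finset.card_nbij'
      (fun Sf => ⟨(redDenoms Sf.2, nonDoubles Sf.2), (redDenomsToBlue Sf.2, greenNonDoubles Sf.2)⟩)
      (fun Q => (Q.1.1 ∪ Q.1.2, dealOf Q.1.1 Q.2.1 Q.1.2 Q.2.2)) ?_ ?_ ?_ ?_
    · rintro ⟨S, f⟩ hf
      obtain ⟨hS, hc, hcard, hred⟩ := (Finset.mem_filter.1 hf).2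
      have h : IsDealOn S f := ⟨hS, hc⟩
      have hcards := h.card_hands_iff.1 hcard
      have hred' : (redDenoms f).card = k := hred
      simp [target, hcards, hred', IsDealOn.redDenomsToBlue_subset, h.greenNonDoubles_subset]
    · rintro ⟨⟨T, W⟩, B, A⟩ hQ
      rw [Finset.mem_coe] at hQ
      simp only [target, Finset.mem_sigma, Finset.mem_product,
        Finset.mem_powersetCard_univ, Finset.mem_filter, Finset.mem_powerset] at hQ
      obtain ⟨⟨hT, hW⟩, ⟨hB, hA⟩, hAB⟩ := hQ
      have h : IsDealOn (T ∪ W) (dealOf T B W A) := isDealOn_dealOf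
      refine Finset.mem_filter.2 ⟨Finset.mem_univ _, h.1, h.2, h.card_hands_iff.2 ?_, ?_⟩
      · rw [nonDoubles_dealOf hA, redDenoms_dealOf hA, greenNonDoubles_dealOf hA,
          redDenomsToBlue_dealOf hB hA]
        exact ⟨hW.trans hT.symm, hAB⟩
      · exact (congrArg Finset.card (redDenoms_dealOf hA)).trans hT
    · rintro ⟨S, f⟩ hf
      obtain ⟨hS, hc, -⟩ := (Finset.mem_filter.1 hf).2
      have h : IsDealOn S f := ⟨hS, hc⟩
      exact Prod.ext h.redDenoms_union_nonDoubles h.dealOf_eq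
    · rintro ⟨⟨T, W⟩, B, A⟩ hQ
      simp only [target, Finset.mem_coe, Finset.mem_sigma, Finset.mem_product,
        Finset.mem_filter, Finset.mem_powerset] at hQ
      obtain ⟨-, ⟨hB, hA⟩, -⟩ := hQ
      simp only [nonDoubles_dealOf hA, redDenoms_dealOf hA, greenNonDoubles_dealOf hA,
        redDenomsToBlue_dealOf hB hA]
  · rw [Finset.card_sigma, Finset.sum_congr rfl (fun Q hQ => card_pairs_subsets_card_eq
      (Finset.mem_powersetCard_univ.1 (Finset.mem_product.1 hQ).1)
      (Finset.mem_powersetCard_univ.1 (Finset.mem_product.1 hQ).2))]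
    simp [sq]
end

section
/- Let n and k be nonnegative integers with k ≤ n. Then ∑_{a=0}^{k} ∑_{b=0}^{k-a} C(k,a) · C(k-a,b) · C(n-k,a) · C(k+a, k-b) = C(n,k) · C(2k,k). -/
/-- Vandermonde's convolution as a sum over a range. -/
theorem sum_range_choose_mul_choose_sub (m n k : ℕ) :
    ∑ i ∈ Finset.range (k + 1), m.choose i * n.choose (k - i) = (m + n).choose k := by
  rw [Nat.add_choose_eq,
    Finset.Nat.sum_antidiagonal_eq_sum_range_succ (fun i j => m.choose i * n.choose j)]

/-- In Vandermonde's convolution the terms beyond the upper index `m` vanish. -/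
theorem sum_range_choose_mul_choose_sub_of_le {m k : ℕ} (n : ℕ) (h : m ≤ k) :
    ∑ i ∈ Finset.range (m + 1), m.choose i * n.choose (k - i) = (m + n).choose k := by
  rw [← sum_range_choose_mul_choose_sub]
  refine Finset.sum_subset (Finset.range_mono (by omega)) fun i _ hi => ?_
  rw [Finset.mem_range, not_lt] at hi
  rw [Nat.choose_eq_zero_of_lt (by omega), zero_mul]

/-- Vandermonde's convolution with one factor reflected. -/
theorem sum_range_choose_mul_choose (k m : ℕ) :
    ∑ a ∈ Finset.range (k + 1), k.choose a * m.choose a = (m + k).choose k := by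
  rw [← sum_range_choose_mul_choose_sub]
  refine Finset.sum_congr rfl fun a ha => ?_
  rw [Nat.choose_symm (Finset.mem_range_succ_iff.mp ha), mul_comm]

theorem double_sum_vandermonde (n k : ℕ) (hk : k ≤ n) :
    ∑ a ∈ Finset.range (k + 1), ∑ b ∈ Finset.range (k - a + 1),
      k.choose a * (k - a).choose b * (n - k).choose a * (k + a).choose (k - b) =
    n.choose k * (2 * k).choose k := by
  have outer := sum_range_choose_mul_choose k (n - k)
  rw [Nat.sub_add_cancel hk] at outer
  rw [← outer, Finset.sum_mul]
  refine Finset.sum_congr rfl fun a ha => ?_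
  have ha' : a ≤ k := Finset.mem_range_succ_iff.mp ha
  have inner := sum_range_choose_mul_choose_sub_of_le (k + a) (Nat.sub_le k a)
  rw [show k - a + (k + a) = 2 * k by omega] at inner
  rw [← inner, Finset.mul_sum]
  exact Finset.sum_congr rfl fun b _ => by ring
end
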